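/- arXiv:2507.00704 — 3 statements merged into one kernel-verified Lean document; each statement's English description precedes it below -/
import Mathlib

section
/- For every real u, v and every r with |r| < 1, the Mehler kernel M_r(u,v) = (1-r^2)^{-1/2} exp((2uvr - (u^2+v^2)r^2)/(2(1-r^2))) equals the sum over q ≥ 0 of H_q(u) H_q(v) r^q / q!, where H_q are the probabilists' Hermite polynomials. -/
/-- Probabilists' Hermite polynomials: `H 0 = 1`, `H 1 = x`,
`H (q+2) x = x * H (q+1) x - (q+1) * H q x`. -/
noncomputable def H : ℕ → ℝ → ℝ
  | 0, _ => 1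
  | 1, x => x
  | (q + 2), x => x * H (q + 1) x - (q + 1) * H q x

open Filter Topology in
theorem abs_H_le (x : ℝ) {ρ : ℝ} (hρ : 1 < ρ) :
    ∃ K : ℝ, ∀ q, |H q x| ≤ K * (ρ ^ q * √(q.factorial : ℝ)) := by
  have hρ0 : 0 < ρ := one_pos.trans hρ
  have hlim : Tendsto (fun q : ℕ => √((q : ℝ) + 2)) atTop atTop :=
    Real.tendsto_sqrt_atTop.comp (tendsto_atTop_add_const_right _ _ tendsto_natCast_atTop_atTop)
  obtain ⟨N, hN⟩ := eventually_atTop.1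
    (hlim.eventually_ge_atTop (|x| * ρ / (ρ ^ 2 - 1)))
  have hw : ∀ q : ℕ, 0 < ρ ^ q * √(q.factorial : ℝ) := fun q => by positivity
  set K := ∑ q ∈ Finset.range (N + 2), |H q x| / (ρ ^ q * √(q.factorial : ℝ))
  have hK0 : 0 ≤ K := Finset.sum_nonneg fun q _ => div_nonneg (abs_nonneg _) (hw q).le
  refine ⟨K, fun q => ?_⟩
  induction q using Nat.strong_induction_on with
  | _ q ih =>
    rcases lt_or_ge q (N + 2) with hq | hq
    · rw [← div_le_iff₀ (hw q)]
      exact Finset.single_le_sum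
        (f := fun q : ℕ => |H q x| / (ρ ^ q * √(q.factorial : ℝ)))
        (fun q _ => div_nonneg (abs_nonneg _) (hw q).le) (Finset.mem_range.2 hq)
    · obtain ⟨p, rfl⟩ : ∃ p, q = p + 2 := ⟨q - 2, by omega⟩
      have h1 := ih (p + 1) (by omega)
      have h0 := ih p (by omega)
      have hp := hN p (by omega)
      rw [div_le_iff₀ (by nlinarith)] at hp
      have e1 : √((p + 1).factorial : ℝ) = √((p : ℝ) + 1) * √(p.factorial : ℝ) := by
        rw [← Real.sqrt_mul (by positivity), Nat.factorial_succ]; push_cast; rfl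
      have e2 : √((p + 2).factorial : ℝ) = √((p : ℝ) + 2) * (√((p : ℝ) + 1) * √(p.factorial : ℝ)) := by
        rw [← e1, ← Real.sqrt_mul (by positivity), Nat.factorial_succ (p + 1)]
        push_cast; ring_nf
      rw [e1] at h1
      rw [e2]
      set a := √((p : ℝ) + 1)
      set b := √((p : ℝ) + 2)
      set f := √(p.factorial : ℝ)
      have ha : a * a = p + 1 := Real.mul_self_sqrt (by positivity)
      have hab : a ≤ b := Real.sqrt_le_sqrt (by linarith)
      have ha0 : 0 ≤ a := Real.sqrt_nonneg _
      have hf0 : 0 ≤ f := Real.sqrt_nonneg _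
      have hkey : |x| * ρ + a ≤ ρ ^ 2 * b := by linarith
      calc |H (p + 2) x| = |x * H (p + 1) x - (p + 1) * H p x| := rfl
        _ ≤ |x| * |H (p + 1) x| + (p + 1) * |H p x| := by
          refine (abs_sub _ _).trans_eq ?_
          rw [abs_mul, abs_mul, abs_of_nonneg (by positivity : (0 : ℝ) ≤ p + 1)]
        _ ≤ |x| * (K * (ρ ^ (p + 1) * (a * f))) + (p + 1) * (K * (ρ ^ p * f)) := by gcongr
        _ = K * ρ ^ p * a * f * (|x| * ρ + a) := by rw [← ha]; ring
        _ ≤ K * ρ ^ p * a * f * (ρ ^ 2 * b) := by gcongr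
        _ = _ := by ring

open Filter Topology in
theorem summable_H_sq (x : ℝ) (i : ℕ) {s : ℝ} (hs0 : 0 ≤ s) (hs : s < 1) :
    Summable fun q : ℕ => H (q + i) x ^ 2 * s ^ q / (q.factorial : ℝ) := by
  obtain ⟨ρ, hρ, hρs⟩ : ∃ ρ : ℝ, 1 < ρ ∧ ρ ^ 2 * s < 1 := by
    have hc : ContinuousAt (fun ρ : ℝ => ρ ^ 2 * s) 1 := by fun_prop
    have h := hc.eventually_lt_const (by simpa using hs : (1 : ℝ) ^ 2 * s < 1)
    exact ((eventually_mem_nhdsWithin (a := (1 : ℝ)) (s := Set.Ioi 1)).and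
      (h.filter_mono nhdsWithin_le_nhds)).exists
  obtain ⟨K, hK⟩ := abs_H_le x hρ
  have hsum := (summable_choose_mul_geometric_of_norm_lt_one (R := ℝ) i (r := ρ ^ 2 * s)
    (by rwa [Real.norm_of_nonneg (by positivity)])).mul_left
      (K ^ 2 * ρ ^ (2 * i) * (i.factorial : ℝ))
  refine hsum.of_nonneg_of_le (fun q => by positivity) fun q => ?_
  have hfac : ((q + i).factorial : ℝ) = (q + i).choose i * q.factorial * i.factorial := by
    have := Nat.add_choose_mul_factorial_mul_factorial q i
    exact_mod_cast this.symm
  have hsq : H (q + i) x ^ 2 ≤ K ^ 2 * ρ ^ (2 * (q + i)) * (q + i).factorial := by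
    have := pow_le_pow_left₀ (abs_nonneg _) (hK (q + i)) 2
    rw [sq_abs, mul_pow, mul_pow, Real.sq_sqrt (by positivity)] at this
    exact this.trans_eq (by ring)
  rw [div_le_iff₀ (by positivity)]
  calc H (q + i) x ^ 2 * s ^ q ≤ K ^ 2 * ρ ^ (2 * (q + i)) * (q + i).factorial * s ^ q := by gcongr
    _ = _ := by rw [hfac]; ring

theorem summable_H_mul_H (u v : ℝ) (i j : ℕ) {r : ℝ} (hr : |r| < 1) :
    Summable fun q : ℕ => H (q + i) u * H (q + j) v * r ^ q / (q.factorial : ℝ) := by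
  refine ((summable_H_sq u i (abs_nonneg r) hr).add
    (summable_H_sq v j (abs_nonneg r) hr)).of_norm_bounded fun q => ?_
  rw [Real.norm_eq_abs, abs_div, abs_mul, abs_mul, abs_pow, Nat.abs_cast, ← add_div, ← add_mul]
  gcongr
  rw [← sq_abs (H (q + i) u), ← sq_abs (H (q + j) v)]
  nlinarith [sq_nonneg (|H (q + i) u| - |H (q + j) v|), sq_nonneg |H (q + i) u|,
    sq_nonneg |H (q + j) v|]

/-- The exponential generating function of `q ↦ H (q + i) u * H (q + j) v`. -/
noncomputable def mehlerSeries (u v : ℝ) (i j : ℕ) (r : ℝ) : ℝ :=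
  ∑' q : ℕ, H (q + i) u * H (q + j) v * r ^ q / (q.factorial : ℝ)

theorem hasSum_mehlerSeries (u v : ℝ) (i j : ℕ) {r : ℝ} (hr : |r| < 1) :
    HasSum (fun q : ℕ => H (q + i) u * H (q + j) v * r ^ q / (q.factorial : ℝ))
      (mehlerSeries u v i j r) :=
  (summable_H_mul_H u v i j hr).hasSum

theorem hasSum_mul_mehlerSeries_succ (u v : ℝ) (i j : ℕ) {r : ℝ} (hr : |r| < 1) :
    HasSum (fun q : ℕ => q * (H (q + i) u * H (q + j) v) * r ^ q / (q.factorial : ℝ))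
      (r * mehlerSeries u v (i + 1) (j + 1) r) := by
  rw [← hasSum_nat_add_iff' 1]
  convert! (hasSum_mehlerSeries u v (i + 1) (j + 1) hr).mul_left r using 1
  · ext q
    rw [Nat.factorial_succ, add_right_comm q 1 i, add_right_comm q 1 j]
    push_cast
    field_simp
    simp only [add_assoc]
    ring
  · simp

theorem H_succ (q : ℕ) (x : ℝ) : H (q + 2) x = x * H (q + 1) x - (q + 1) * H q x := rfl

theorem hasDerivAt_mehlerSeries (u v : ℝ) (i j : ℕ) {r : ℝ} (hr : |r| < 1) :
    HasDerivAt (mehlerSeries u v i j) (mehlerSeries u v (i + 1) (j + 1) r) r := by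
  obtain ⟨s, hrs, hs⟩ := exists_between hr
  have hs0 : 0 < s := (abs_nonneg r).trans_lt hrs
  have hs' : |s| < 1 := by rwa [abs_of_pos hs0]
  have hderiv : ∀ (q : ℕ) (y : ℝ), HasDerivAt
      (fun y => H (q + i) u * H (q + j) v * y ^ q / (q.factorial : ℝ))
      (H (q + i) u * H (q + j) v * (q * y ^ (q - 1)) / (q.factorial : ℝ)) y := fun q y =>
    ((hasDerivAt_pow q y).const_mul _).div_const _
  have hshift : ∀ (q : ℕ) (y : ℝ), H (q + 1 + i) u * H (q + 1 + j) v *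
      ((q + 1 : ℕ) * y ^ (q + 1 - 1)) / ((q + 1).factorial : ℝ) =
      H (q + (i + 1)) u * H (q + (j + 1)) v * y ^ q / (q.factorial : ℝ) := fun q y => by
    rw [Nat.factorial_succ, add_right_comm q 1 i, add_right_comm q 1 j]
    push_cast
    field_simp
    simp only [add_assoc]
    ring
  have hbound : Summable fun q : ℕ =>
      |H (q + i) u * H (q + j) v * (q * s ^ (q - 1)) / (q.factorial : ℝ)| := by
    rw [← summable_nat_add_iff 1]
    simpa only [hshift] using (summable_H_mul_H u v (i + 1) (j + 1) hs').abs
  have hmain := hasDerivAt_tsum_of_isPreconnected hbound Metric.isOpen_ball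
    (convex_ball (0 : ℝ) s).isPreconnected (fun q y _ => hderiv q y)
    (fun q y hy => by
      rw [mem_ball_zero_iff, Real.norm_eq_abs] at hy
      simp only [Real.norm_eq_abs, abs_div, abs_mul, abs_pow, Nat.abs_cast, abs_of_pos hs0]
      gcongr)
    (Metric.mem_ball_self hs0) (summable_H_mul_H u v i j (by simp))
    (y := r) (by simpa using hrs)
  refine hmain.congr_deriv ((hasSum_nat_add_iff' 1).1 ?_).tsum_eq
  simpa only [hshift, Finset.range_one, Finset.sum_singleton, Nat.cast_zero, zero_mul, mul_zero,
    zero_div, sub_zero] using hasSum_mehlerSeries u v (i + 1) (j + 1) hr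

theorem H_one_add (q : ℕ) (x : ℝ) : H (q + 1) x = x * H q x - q * H (q - 1) x := by
  cases q with
  | zero => simp [H]
  | succ q => simp [H]

theorem mehlerSeries_comm (u v : ℝ) (i j : ℕ) (r : ℝ) :
    mehlerSeries u v i j r = mehlerSeries v u j i r := by
  simp only [mehlerSeries, mul_comm (H _ u)]

theorem mehlerSeries_one_left (u v : ℝ) (j : ℕ) {r : ℝ} (hr : |r| < 1) :
    mehlerSeries u v 1 j r =
      u * mehlerSeries u v 0 j r - r * mehlerSeries u v 0 (j + 1) r := by
  have hlow : HasSum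
      (fun q : ℕ => q * (H (q - 1) u * H (q + j) v) * r ^ q / (q.factorial : ℝ))
      (r * mehlerSeries u v 0 (j + 1) r) := by
    rw [← hasSum_nat_add_iff' 1]
    convert! (hasSum_mehlerSeries u v 0 (j + 1) hr).mul_left r using 1
    · ext q
      rw [Nat.factorial_succ, add_right_comm q 1 j]
      push_cast
      field_simp
      simp only [add_assoc, add_zero]
      ring
    · simp
  refine (hasSum_mehlerSeries u v 1 j hr).unique ?_
  convert! ((hasSum_mehlerSeries u v 0 j hr).mul_left u).sub hlow using 1
  ext q
  rw [H_one_add]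
  simp only [add_zero]
  ring

theorem mehlerSeries_zero_two (u v : ℝ) {r : ℝ} (hr : |r| < 1) :
    mehlerSeries u v 0 2 r = v * mehlerSeries u v 0 1 r -
      (mehlerSeries u v 0 0 r + r * mehlerSeries u v 1 1 r) := by
  refine (hasSum_mehlerSeries u v 0 2 hr).unique ?_
  convert! ((hasSum_mehlerSeries u v 0 1 hr).mul_left v).sub
    ((hasSum_mehlerSeries u v 0 0 hr).add (hasSum_mul_mehlerSeries_succ u v 0 0 hr)) using 1
  ext q
  rw [H_succ]
  simp only [add_zero]
  ring

/-- The linear differential equation in `r` satisfied by the Mehler series. -/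
theorem mehlerSeries_ode (u v : ℝ) {r : ℝ} (hr : |r| < 1) :
    (1 - r ^ 2) ^ 2 * mehlerSeries u v 1 1 r =
      ((u - r * v) * (v - r * u) + r * (1 - r ^ 2)) * mehlerSeries u v 0 0 r := by
  have h1 := mehlerSeries_one_left u v 0 hr
  have h2 := mehlerSeries_one_left v u 0 hr
  rw [mehlerSeries_comm v u, mehlerSeries_comm v u 0 0, mehlerSeries_comm v u 0] at h2
  have h3 := mehlerSeries_one_left u v 1 hr
  have h4 := mehlerSeries_zero_two u v hr
  have h5 : (1 - r ^ 2) * mehlerSeries u v 0 1 r = (v - r * u) * mehlerSeries u v 0 0 r := by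
    linear_combination h2 - r * h1
  linear_combination (1 - r ^ 2) * (h3 - r * h4) + (u - r * v) * h5

theorem hasDerivAt_mehler_kernel_inv (u v : ℝ) {r : ℝ} (hr : |r| < 1) :
    HasDerivAt (fun r : ℝ => √(1 - r ^ 2) *
        Real.exp (-((2 * u * v * r - (u ^ 2 + v ^ 2) * r ^ 2) / (2 * (1 - r ^ 2)))))
      (-(((u - r * v) * (v - r * u) + r * (1 - r ^ 2)) / (1 - r ^ 2) ^ 2) * (√(1 - r ^ 2) *
        Real.exp (-((2 * u * v * r - (u ^ 2 + v ^ 2) * r ^ 2) / (2 * (1 - r ^ 2)))))) r := by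
  have hpos : 0 < 1 - r ^ 2 := sub_pos.2 ((sq_lt_one_iff_abs_lt_one r).2 hr)
  have hquad : HasDerivAt (fun r : ℝ => 1 - r ^ 2) (-(2 * r)) r := by
    simpa using (hasDerivAt_pow 2 r).const_sub 1
  have hsqrt := hquad.sqrt hpos.ne'
  have hnum : HasDerivAt (fun r : ℝ => 2 * u * v * r - (u ^ 2 + v ^ 2) * r ^ 2)
      (2 * u * v - (u ^ 2 + v ^ 2) * (2 * r)) r := by
    simpa using ((hasDerivAt_id r).const_mul (2 * u * v)).fun_sub
      ((hasDerivAt_pow 2 r).const_mul (u ^ 2 + v ^ 2))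
  have hexp := (hnum.div (hquad.const_mul 2) (by positivity)).neg.exp
  refine (hsqrt.mul hexp).congr_deriv ?_
  have hs : √(1 - r ^ 2) ^ 2 = 1 - r ^ 2 := Real.sq_sqrt hpos.le
  have hs0 : √(1 - r ^ 2) ≠ 0 := (Real.sqrt_pos.2 hpos).ne'
  simp only [Pi.neg_apply, Pi.div_apply]
  generalize Real.exp _ = e
  have hd : -(2 * r) / (2 * √(1 - r ^ 2)) = -r / (1 - r ^ 2) * √(1 - r ^ 2) := by
    rw [div_mul_eq_mul_div, div_eq_div_iff (by positivity) hpos.ne']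
    linear_combination (2 * r) * hs
  rw [hd]
  have := hpos.ne'
  field_simp
  ring

/-- Mehler's formula: for `|r| < 1`, the Mehler kernel equals
`∑_{q ≥ 0} H_q(u) H_q(v) r^q / q!`. -/
theorem mehler_formula (u v r : ℝ) (hr : |r| < 1) :
    (Real.sqrt (1 - r ^ 2))⁻¹ *
        Real.exp ((2 * u * v * r - (u ^ 2 + v ^ 2) * r ^ 2) / (2 * (1 - r ^ 2)))
      = ∑' q : ℕ, H q u * H q v * r ^ q / (Nat.factorial q : ℝ) := by
  have hpos : 0 < 1 - r ^ 2 := sub_pos.2 ((sq_lt_one_iff_abs_lt_one r).2 hr)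
  have hderiv : ∀ t ∈ Metric.ball (0 : ℝ) 1, HasDerivAt (fun r : ℝ => mehlerSeries u v 0 0 r *
      (√(1 - r ^ 2) *
        Real.exp (-((2 * u * v * r - (u ^ 2 + v ^ 2) * r ^ 2) / (2 * (1 - r ^ 2)))))) 0 t := by
    intro t ht
    rw [mem_ball_zero_iff, Real.norm_eq_abs] at ht
    have htpos : 0 < 1 - t ^ 2 := sub_pos.2 ((sq_lt_one_iff_abs_lt_one t).2 ht)
    refine ((hasDerivAt_mehlerSeries u v 0 0 ht).mul
      (hasDerivAt_mehler_kernel_inv u v ht)).congr_deriv ?_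
    have hode := mehlerSeries_ode u v ht
    rw [mul_comm, ← eq_div_iff (by positivity)] at hode
    rw [zero_add, hode]
    ring
  have hconst := Metric.isOpen_ball.is_const_of_deriv_eq_zero
    (convex_ball (0 : ℝ) 1).isPreconnected
    (fun t ht => (hderiv t ht).differentiableAt.differentiableWithinAt)
    (fun t ht => (hderiv t ht).deriv) (x := r) (y := 0) (by simpa using hr) (by simp)
  have hzero : mehlerSeries u v 0 0 0 = 1 := by
    rw [mehlerSeries, tsum_eq_single 0 fun q hq => by simp [hq]]
    simp [H]
  simp only [hzero, Real.exp_neg] at hconst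
  change _ = mehlerSeries u v 0 0 r
  have hs0 : √(1 - r ^ 2) ≠ 0 := (Real.sqrt_pos.2 hpos).ne'
  have he0 := (Real.exp_pos ((2 * u * v * r - (u ^ 2 + v ^ 2) * r ^ 2) / (2 * (1 - r ^ 2)))).ne'
  generalize Real.exp ((2 * u * v * r - (u ^ 2 + v ^ 2) * r ^ 2) / (2 * (1 - r ^ 2))) = e at *
  simp at hconst
  field_simp at hconst ⊢
  linarith
end

section
/- If N and N' are independent standard Gaussian random variables and r ∈ (-1,1), then for all real u, v: Cov(1_{N ≥ u}, 1_{rN + √(1-r^2) N' ≥ v}) = Σ_{q≥1} H_{q-1}(u) H_{q-1}(v) φ(u) φ(v) r^q / q!. -/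
open MeasureTheory ProbabilityTheory

/-- Standard Gaussian density. -/
noncomputable def gφ (x : ℝ) : ℝ := Real.exp (-x ^ 2 / 2) / Real.sqrt (2 * Real.pi)

open Complex in
/-- Generating function of any sequence satisfying a Hermite-type three-term recurrence. -/
theorem hasSum_of_hermite_recurrence {a : ℕ → ℂ} {x ε : ℂ} (h0 : a 0 = 1) (h1 : a 1 = x)
    (h2 : ∀ n, a (n + 2) = x * a (n + 1) - ε * (n + 1) * a n) (z : ℂ) :
    HasSum (fun n => a n * z ^ n / (n.factorial : ℂ)) (exp (x * z - ε * z ^ 2 / 2)) := by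
  set f : ℂ → ℂ := fun z => exp (x * z - ε * z ^ 2 / 2) with hf
  have hfd : ContDiff ℂ ⊤ f := by rw [hf]; fun_prop
  have hderiv : ∀ z, deriv f z = (x - ε * z) * f z := by
    intro z
    have : HasDerivAt (fun z => x * z - ε * z ^ 2 / 2) (x - ε * z) z := by
      have := ((hasDerivAt_id' z).const_mul x).sub
        ((((hasDerivAt_pow 2 z).const_mul ε)).div_const 2)
      refine this.congr_deriv ?_
      push_cast; ring
    rw [hf, this.cexp.deriv]; ring
  have hdiff : ∀ n z, DifferentiableAt ℂ (iteratedDeriv n f) z := fun n z =>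
    (hfd.differentiable_iteratedDeriv n (WithTop.coe_lt_top _)) z
  have hrec : ∀ n, iteratedDeriv (n + 2) f = fun z =>
      (x - ε * z) * iteratedDeriv (n + 1) f z - ε * (n + 1) * iteratedDeriv n f z := by
    intro n
    induction n with
    | zero =>
      have e : iteratedDeriv 1 f = fun z => (x - ε * z) * f z := by
        rw [iteratedDeriv_one]; exact funext hderiv
      funext z
      rw [iteratedDeriv_succ, e]
      have hd := ((((hasDerivAt_id' z).const_mul ε).const_sub x)).mul (hdiff 0 z).hasDerivAt
      rw [iteratedDeriv_zero, hderiv] at hd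
      refine (hd.deriv).trans ?_
      simp only [iteratedDeriv_zero]
      push_cast; ring
    | succ n ih =>
      funext z
      rw [iteratedDeriv_succ, ih]
      have hd := (((((hasDerivAt_id' z).const_mul ε).const_sub x)).mul
        (hdiff (n + 1) z).hasDerivAt).sub ((hdiff n z).hasDerivAt.const_mul (ε * (n + 1)))
      refine (hd.deriv).trans ?_
      rw [← iteratedDeriv_succ, ← iteratedDeriv_succ]
      push_cast
      linear_combination (x - ε * z) * congrFun ih z
  have hval : ∀ n, iteratedDeriv n f 0 = a n ∧ iteratedDeriv (n + 1) f 0 = a (n + 1) := by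
    intro n
    induction n with
    | zero => simp [h0, h1, iteratedDeriv_one, hderiv]; simp [hf]
    | succ n ih =>
      refine ⟨ih.2, ?_⟩
      rw [hrec n, h2, ← ih.1, ← ih.2]; simp
  have := Complex.hasSum_taylorSeries_of_entire (hfd.differentiable (by simp)) 0 z
  convert this using 2 with n
  · rfl
  · rw [(hval _).1]; simp; ring

/-- The Hermite polynomials with all signs made positive, evaluated at `|x|`. -/
noncomputable def hermiteMajorant (x : ℝ) : ℕ → ℝ
  | 0 => 1
  | 1 => |x|
  | (q + 2) => |x| * hermiteMajorant x (q + 1) + (q + 1) * hermiteMajorant x q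

theorem abs_H_le_hermiteMajorant (x : ℝ) : ∀ q, |H q x| ≤ hermiteMajorant x q
  | 0 => by simp [H, hermiteMajorant]
  | 1 => by simp [H, hermiteMajorant]
  | (q + 2) => by
    have h1 := abs_H_le_hermiteMajorant x (q + 1)
    have h2 := abs_H_le_hermiteMajorant x q
    rw [H, hermiteMajorant]
    refine (abs_sub _ _).trans ?_
    rw [abs_mul, abs_mul, abs_of_nonneg (by positivity : (0 : ℝ) ≤ q + 1)]
    gcongr

theorem hasSum_hermiteMajorant (x t : ℝ) :
    HasSum (fun q => hermiteMajorant x q * t ^ q / (q.factorial : ℝ))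
      (Real.exp (|x| * t + t ^ 2 / 2)) := by
  have := hasSum_of_hermite_recurrence (a := fun q => (hermiteMajorant x q : ℂ)) (x := (|x| : ℝ))
    (ε := -1) (by simp [hermiteMajorant]) (by simp [hermiteMajorant])
    (fun n => by simp only [hermiteMajorant]; push_cast; ring) t
  rw [← Complex.hasSum_ofReal]
  push_cast
  convert this using 2
  ring

theorem hasSum_H (x : ℝ) (z : ℂ) :
    HasSum (fun q => (H q x : ℂ) * z ^ q / (q.factorial : ℂ))
      (Complex.exp (x * z - z ^ 2 / 2)) := by
  have := hasSum_of_hermite_recurrence (a := fun q => (H q x : ℂ)) (x := x)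
    (ε := 1) (by simp [H]) (by simp [H])
    (fun n => by simp only [H]; push_cast; ring) z
  simpa using this

open Complex in
/-- The integrand of the Fourier representation of `H q u * gφ u`. -/
noncomputable def hermiteKernel (u : ℝ) (q : ℕ) (t : ℝ) : ℂ :=
  (I * t) ^ q * exp (-(1 / 2 : ℂ) * t ^ 2 + (-(I * u)) * t)

open Complex in
theorem norm_hermiteKernel (u : ℝ) (q : ℕ) (t : ℝ) :
    ‖hermiteKernel u q t‖ = |t| ^ q * Real.exp (-(1 / 2) * t ^ 2) := by
  rw [hermiteKernel, norm_mul, norm_pow, norm_mul, norm_I, one_mul, norm_real, Real.norm_eq_abs,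
    norm_exp]
  congr 2
  have : (-(1 / 2 : ℂ) * t ^ 2 + (-(I * u)) * t)
      = ((-(1 / 2) * t ^ 2 : ℝ) : ℂ) + ((-(u * t) : ℝ) : ℂ) * I := by push_cast; ring
  rw [this]; simp only [add_re, ofReal_re, re_ofReal_mul, I_re]; simp

theorem continuous_hermiteKernel (u : ℝ) (q : ℕ) : Continuous (hermiteKernel u q) := by
  unfold hermiteKernel; fun_prop

theorem integrable_hermiteKernel (u : ℝ) (q : ℕ) : Integrable (hermiteKernel u q) := by
  have h := (integrable_rpow_mul_exp_neg_mul_sq (b := 1 / 2) (by norm_num) (s := q)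
    (by have : (0 : ℝ) ≤ q := by positivity
        linarith)).norm
  refine h.mono' (continuous_hermiteKernel u q).aestronglyMeasurable (ae_of_all _ fun t => ?_)
  rw [norm_hermiteKernel, norm_mul, Real.rpow_natCast, norm_pow, Real.norm_eq_abs,
    Real.norm_eq_abs, Real.abs_exp]

open Complex in
theorem hasDerivAt_hermiteKernel (u : ℝ) (q : ℕ) (t : ℝ) :
    HasDerivAt (hermiteKernel u q)
      (I * q * hermiteKernel u (q - 1) t + I * hermiteKernel u (q + 2 - 1) t
        - I * u * hermiteKernel u q t) t := by
  have h1 : HasDerivAt (fun t : ℝ => (I * t) ^ q) (q * (I * t) ^ (q - 1) * I) t := by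
    have := ((hasDerivAt_id' (t : ℂ)).const_mul I).pow q
    simpa using this.comp_ofReal
  have h2 : HasDerivAt (fun t : ℝ => exp (-(1 / 2 : ℂ) * t ^ 2 + (-(I * u)) * t))
      (exp (-(1 / 2 : ℂ) * t ^ 2 + (-(I * u)) * t) * (-t - I * u)) t := by
    have := ((((hasDerivAt_id' (t : ℂ)).pow 2).const_mul (-(1 / 2 : ℂ))).add
      ((hasDerivAt_id' (t : ℂ)).const_mul (-(I * u)))).cexp.comp_ofReal
    refine this.congr_deriv ?_
    simp; ring
  refine (h1.mul h2).congr_deriv ?_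
  simp only [hermiteKernel, Nat.add_succ_sub_one]
  linear_combination (-(I * t) ^ q * exp (-(1 / 2 : ℂ) * t ^ 2 + (-(I * u)) * t) * t) * I_sq

open Complex in
theorem integral_hermiteKernel_recurrence (u : ℝ) (q : ℕ) :
    ∫ t, hermiteKernel u (q + 1) t
      = u * (∫ t, hermiteKernel u q t) - q * ∫ t, hermiteKernel u (q - 1) t := by
  have i0 := (integrable_hermiteKernel u (q - 1)).const_mul (I * q)
  have i1 := (integrable_hermiteKernel u (q + 2 - 1)).const_mul I
  have i2 := (integrable_hermiteKernel u q).const_mul (I * u)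
  have h := integral_eq_zero_of_hasDerivAt_of_integrable (hasDerivAt_hermiteKernel u q)
    ((i0.add i1).sub i2) (integrable_hermiteKernel u q)
  rw [integral_sub (by exact i0.add i1) i2, integral_add i0 i1,
    integral_const_mul, integral_const_mul, integral_const_mul, Nat.add_succ_sub_one] at h
  have : I * (∫ t, hermiteKernel u (q + 1) t)
      = I * (u * (∫ t, hermiteKernel u q t) - q * ∫ t, hermiteKernel u (q - 1) t) := by
    linear_combination h
  exact mul_left_cancel₀ I_ne_zero this

open Complex in
/-- Fourier transform of a real Gaussian, with the values written as real numbers. -/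
theorem integral_cexp_neg_mul_sq_sub (b c : ℝ) (hb : 0 < b) :
    ∫ t : ℝ, exp (-(b / 2 : ℂ) * t ^ 2 + (-(I * c)) * t)
      = ((2 * Real.pi * (gφ (c / √b) / √b) : ℝ) : ℂ) := by
  have h := integral_cexp_quadratic (b := -(b / 2 : ℂ))
    (by have : (-(b / 2 : ℂ)) = ((-(b / 2) : ℝ) : ℂ) := by push_cast; ring
        rw [this, ofReal_re]; linarith) (-(I * c)) 0
  simp only [add_zero] at h
  rw [h]
  have e1 : ((Real.pi : ℂ) / -(-(b / 2 : ℂ))) = ((2 * Real.pi / b : ℝ) : ℂ) := by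
    push_cast; field_simp
  have e2 : (1 / 2 : ℂ) = ((1 / 2 : ℝ) : ℂ) := by push_cast; ring
  have hb0 : (b : ℂ) ≠ 0 := by exact_mod_cast hb.ne'
  have e3 : (0 : ℂ) - (-(I * c)) ^ 2 / (4 * -(b / 2 : ℂ)) = ((-(c / √b) ^ 2 / 2 : ℝ) : ℂ) := by
    rw [div_pow, Real.sq_sqrt hb.le]
    push_cast
    field_simp
    linear_combination (4 * (c : ℂ) ^ 2) * I_sq
  rw [e1, e2, e3, ← ofReal_cpow (by positivity), ← ofReal_exp, ← ofReal_mul,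
    ← Real.sqrt_eq_rpow, gφ, Real.sqrt_div (by positivity)]
  congr 1
  have hp : √(2 * Real.pi) ≠ 0 := by positivity
  have hp2 : √(2 * Real.pi) ^ 2 = 2 * Real.pi := Real.sq_sqrt (by positivity)
  have hs : √b ≠ 0 := by positivity
  field_simp
  exact hp2

theorem integral_hermiteKernel (u : ℝ) :
    ∀ q, ∫ t, hermiteKernel u q t = ((2 * Real.pi * (H q u * gφ u) : ℝ) : ℂ)
  | 0 => by
    have := integral_cexp_neg_mul_sq_sub 1 u one_pos
    simpa [hermiteKernel, H] using this
  | 1 => by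
    rw [integral_hermiteKernel_recurrence, integral_hermiteKernel u 0]
    simp [H]; ring
  | (q + 2) => by
    rw [integral_hermiteKernel_recurrence, Nat.add_sub_cancel, integral_hermiteKernel u (q + 1),
      integral_hermiteKernel u q, H]
    push_cast; ring

open Complex in
/-- Mehler's formula. -/
theorem hasSum_mehler {r : ℝ} (hr : |r| < 1) (u v : ℝ) :
    HasSum (fun q : ℕ => H q u * H q v * gφ u * r ^ q / (q.factorial : ℝ))
      (gφ ((u - r * v) / √(1 - r ^ 2)) / √(1 - r ^ 2)) := by
  have hr2 : 0 < 1 - r ^ 2 := by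
    have := (sq_lt_one_iff_abs_lt_one r).2 hr; linarith
  have key := hasSum_integral_of_dominated_convergence (μ := volume)
    (F := fun (q : ℕ) (t : ℝ) => (H q v * r ^ q / q.factorial : ℂ) * hermiteKernel u q t)
    (f := fun t : ℝ => exp (-(((1 - r ^ 2 : ℝ) : ℂ) / 2) * t ^ 2
      + (-(I * ((u - r * v : ℝ) : ℂ))) * t))
    (fun q t => hermiteMajorant v q * (|r * t|) ^ q / q.factorial * Real.exp (-(1 / 2) * t ^ 2))
    (fun q => ((continuous_hermiteKernel u q).const_mul _).aestronglyMeasurable)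
    (fun q => ae_of_all _ fun t => ?_)
    (ae_of_all _ fun t => ((hasSum_hermiteMajorant v (|r * t|)).mul_right _).summable)
    ?_
    (ae_of_all _ fun t => ?_)
  · rw [integral_cexp_neg_mul_sq_sub _ _ hr2] at key
    simp_rw [integral_const_mul, integral_hermiteKernel] at key
    have key' : HasSum (fun q : ℕ => H q v * r ^ q / q.factorial * (2 * Real.pi * (H q u * gφ u)))
        (2 * Real.pi * (gφ ((u - r * v) / √(1 - r ^ 2)) / √(1 - r ^ 2))) := by
      rw [← Complex.hasSum_ofReal]
      exact_mod_cast key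
    have hpi : (2 * Real.pi) ≠ 0 := by positivity
    have := key'.mul_left (2 * Real.pi)⁻¹
    rw [inv_mul_cancel_left₀ hpi] at this
    convert this using 2 with q
    · rfl
    · field_simp
  · rw [norm_mul, norm_hermiteKernel, norm_div, norm_mul, norm_pow, norm_real, norm_real,
      Complex.norm_natCast, Real.norm_eq_abs, Real.norm_eq_abs, abs_mul, mul_pow]
    have := abs_H_le_hermiteMajorant v q
    calc |H q v| * |r| ^ q / q.factorial * (|t| ^ q * Real.exp (-(1 / 2) * t ^ 2))
        ≤ hermiteMajorant v q * |r| ^ q / q.factorial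
          * (|t| ^ q * Real.exp (-(1 / 2) * t ^ 2)) := by gcongr
      _ = _ := by ring
  · have e : ∀ t : ℝ, ∑' q : ℕ, hermiteMajorant v q * (|r * t|) ^ q / q.factorial
        * Real.exp (-(1 / 2) * t ^ 2)
        = Real.exp (|v| * |r * t| + |r * t| ^ 2 / 2) * Real.exp (-(1 / 2) * t ^ 2) :=
      fun t => ((hasSum_hermiteMajorant v (|r * t|)).mul_right _).tsum_eq
    simp_rw [e]
    have hb : 0 < (((1 - r ^ 2) / 2 : ℝ) : ℂ).re := by rw [ofReal_re]; linarith
    have hi : ∀ c : ℝ, Integrable fun t : ℝ => Real.exp (-((1 - r ^ 2) / 2) * t ^ 2 + c * t) := by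
      intro c
      have := (integrable_cexp_quadratic hb c 0).norm
      refine this.congr (ae_of_all _ fun t => ?_)
      have : -(((1 - r ^ 2) / 2 : ℝ) : ℂ) * (t : ℂ) ^ 2 + c * t + 0
        = ((-((1 - r ^ 2) / 2) * t ^ 2 + c * t : ℝ) : ℂ) := by push_cast; ring
      simp only [this, norm_exp, ofReal_re]
    refine ((hi (|v| * r)).add (hi (-(|v| * r)))).mono' (by fun_prop) (ae_of_all _ fun t => ?_)
    rw [← Real.exp_add, Real.norm_eq_abs, Real.abs_exp, Pi.add_apply, sq_abs]
    rcases abs_cases (r * t) with ⟨h, -⟩ | ⟨h, -⟩ <;> rw [h]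
    · refine le_add_of_le_of_nonneg (Real.exp_le_exp.2 (le_of_eq ?_)) (Real.exp_pos _).le
      ring
    · refine le_add_of_nonneg_of_le (Real.exp_pos _).le (Real.exp_le_exp.2 (le_of_eq ?_))
      ring
  · have := (hasSum_H v (r * (I * t))).mul_right (exp (-(1 / 2 : ℂ) * t ^ 2 + (-(I * u)) * t))
    rw [← exp_add] at this
    convert this using 2 with q
    · rfl
    · rw [hermiteKernel, mul_pow (r : ℂ)]; ring
    · push_cast
      linear_combination ((r : ℂ) ^ 2 * t ^ 2 / 2) * I_sq

theorem gφ_eq_gaussianPDFReal : gφ = gaussianPDFReal 0 1 := by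
  funext x
  simp [gφ, gaussianPDFReal, div_eq_inv_mul]

theorem continuous_gφ : Continuous gφ := by
  unfold gφ; fun_prop

theorem gφ_pos (x : ℝ) : 0 < gφ x := by
  unfold gφ; positivity

theorem gφ_le_one (x : ℝ) : gφ x ≤ 1 := by
  unfold gφ
  rw [div_le_one (by positivity)]
  have h1 : Real.exp (-x ^ 2 / 2) ≤ 1 := Real.exp_le_one_iff.2 (by nlinarith [sq_nonneg x])
  have h2 : 1 ≤ √(2 * Real.pi) := Real.one_le_sqrt.2 (by linarith [Real.pi_gt_three])
  exact h1.trans h2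

theorem integrable_gφ : Integrable gφ := by
  rw [gφ_eq_gaussianPDFReal]; exact integrable_gaussianPDFReal 0 1

theorem hasDerivAt_gφ (x : ℝ) : HasDerivAt gφ (-x * gφ x) x := by
  have h := (((hasDerivAt_pow 2 x).neg.div_const 2).exp).div_const √(2 * Real.pi)
  refine h.congr_deriv ?_
  simp [gφ]; ring

theorem tendsto_gφ_atTop : Filter.Tendsto gφ Filter.atTop (nhds 0) := by
  have h : Filter.Tendsto (fun x : ℝ => x ^ 2 / 2) Filter.atTop Filter.atTop :=
    (Filter.tendsto_pow_atTop two_ne_zero).atTop_div_const two_pos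
  have := (Real.tendsto_exp_neg_atTop_nhds_zero.comp h).div_const √(2 * Real.pi)
  rw [zero_div] at this
  refine this.congr fun x => ?_
  simp [gφ, neg_div]

theorem integrable_gφ_mul_abs_add (c : ℝ) : Integrable fun x => gφ x * (|x| + c) := by
  have h := (integrable_rpow_mul_exp_neg_mul_sq (b := 1 / 2) (by norm_num) (s := 1)
    (by norm_num)).norm.div_const √(2 * Real.pi)
  refine (h.add (integrable_gφ.mul_const c)).congr (ae_of_all _ fun x => ?_)
  simp only [Pi.add_apply, gφ, norm_mul, Real.rpow_one, Real.norm_eq_abs, Real.abs_exp]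
  ring_nf

/-- The tail of the standard Gaussian distribution. -/
noncomputable def gaussianTail (a : ℝ) : ℝ := ∫ y in Set.Ioi a, gφ y

theorem hasDerivAt_gaussianTail (a : ℝ) : HasDerivAt gaussianTail (-gφ a) a := by
  have h : gaussianTail = fun x => gaussianTail 0 - ∫ y in (0 : ℝ)..x, gφ y := by
    funext x
    rw [← intervalIntegral.integral_Ioi_sub_Ioi' integrable_gφ.integrableOn
      integrable_gφ.integrableOn]
    simp [gaussianTail]
  rw [h]
  exact (intervalIntegral.integral_hasDerivAt_right (continuous_gφ.intervalIntegrable _ _)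
    (continuous_gφ.stronglyMeasurableAtFilter _ _) continuous_gφ.continuousAt).const_sub _

theorem continuous_gaussianTail : Continuous gaussianTail :=
  continuous_iff_continuousAt.2 fun a => (hasDerivAt_gaussianTail a).continuousAt

theorem gaussianTail_eq_integral (a : ℝ) :
    ∫ y, (Set.Ici a).indicator (fun _ => (1 : ℝ)) y ∂gaussianReal 0 1 = gaussianTail a := by
  rw [integral_gaussianReal_eq_integral_smul one_ne_zero, gaussianTail,
    ← integral_Ici_eq_integral_Ioi, ← integral_indicator measurableSet_Ici,
    gφ_eq_gaussianPDFReal]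
  refine integral_congr_ae (ae_of_all _ fun y => ?_)
  by_cases h : y ∈ Set.Ici a <;> simp [h]

theorem norm_gaussianTail_le_one (a : ℝ) : ‖gaussianTail a‖ ≤ 1 := by
  have h1 : ∫ y, gφ y = 1 := by
    rw [gφ_eq_gaussianPDFReal]; exact integral_gaussianPDFReal_eq_one 0 one_ne_zero
  rw [gaussianTail,
    Real.norm_of_nonneg (setIntegral_nonneg measurableSet_Ioi fun y _ => (gφ_pos y).le), ← h1]
  exact setIntegral_le_integral integrable_gφ (ae_of_all _ fun y => (gφ_pos y).le)

/-- `P(N ≥ u, rN + √(1-r²)N' ≥ v)`, computed by conditioning on `N`. -/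
noncomputable def gaussianQuadrant (u v r : ℝ) : ℝ :=
  ∫ x in Set.Ioi u, gφ x * gaussianTail ((v - r * x) / √(1 - r ^ 2))

theorem gaussianQuadrant_zero (u v : ℝ) :
    gaussianQuadrant u v 0 = gaussianTail u * gaussianTail v := by
  simp [gaussianQuadrant, integral_mul_const, gaussianTail]

theorem gφ_mul_gφ_rotation {r : ℝ} (hr : 0 < 1 - r ^ 2) (x v : ℝ) :
    gφ x * gφ ((v - r * x) / √(1 - r ^ 2)) = gφ v * gφ ((x - r * v) / √(1 - r ^ 2)) := by
  simp only [gφ]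
  rw [div_mul_div_comm, div_mul_div_comm, ← Real.exp_add, ← Real.exp_add, div_pow, div_pow,
    Real.sq_sqrt hr.le]
  congr 2
  field_simp
  ring

theorem hasDerivAt_conditional_threshold {r : ℝ} (hr : 0 < 1 - r ^ 2) (x v : ℝ) :
    HasDerivAt (fun r => (v - r * x) / √(1 - r ^ 2)) (-((x - r * v) / √(1 - r ^ 2) ^ 3)) r := by
  have hs : HasDerivAt (fun r => √(1 - r ^ 2)) (-(r / √(1 - r ^ 2))) r := by
    refine (((hasDerivAt_pow 2 r).const_sub 1).sqrt hr.ne').congr_deriv ?_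
    field_simp
    simp
  have hpos : 0 < √(1 - r ^ 2) := Real.sqrt_pos.2 hr
  refine ((((hasDerivAt_id' r).mul_const x).const_sub v).div hs hpos.ne').congr_deriv ?_
  have hsq : √(1 - r ^ 2) ^ 2 = 1 - r ^ 2 := Real.sq_sqrt hr.le
  field_simp
  rw [hsq]
  ring

theorem integral_deriv_gaussianQuadrant {r : ℝ} (hr : 0 < 1 - r ^ 2) (u v : ℝ)
    (hi : Integrable (fun x => gφ x * (gφ ((v - r * x) / √(1 - r ^ 2))
      * ((x - r * v) / √(1 - r ^ 2) ^ 3))) (volume.restrict (Set.Ioi u))) :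
    ∫ x in Set.Ioi u, gφ x * (gφ ((v - r * x) / √(1 - r ^ 2)) * ((x - r * v) / √(1 - r ^ 2) ^ 3))
      = gφ v * (gφ ((u - r * v) / √(1 - r ^ 2)) / √(1 - r ^ 2)) := by
  have hpos : 0 < √(1 - r ^ 2) := Real.sqrt_pos.2 hr
  have hd : ∀ x, HasDerivAt
      (fun x => -(gφ v * (gφ ((x - r * v) / √(1 - r ^ 2)) / √(1 - r ^ 2))))
      (gφ x * (gφ ((v - r * x) / √(1 - r ^ 2)) * ((x - r * v) / √(1 - r ^ 2) ^ 3))) x := by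
    intro x
    have h1 := (hasDerivAt_gφ ((x - r * v) / √(1 - r ^ 2))).comp x
      (((hasDerivAt_id' x).sub_const (r * v)).div_const √(1 - r ^ 2))
    refine ((h1.div_const √(1 - r ^ 2)).const_mul (gφ v)).neg.congr_deriv ?_
    rw [← mul_assoc, gφ_mul_gφ_rotation hr]
    field_simp
  have hlim : Filter.Tendsto (fun x => -(gφ v * (gφ ((x - r * v) / √(1 - r ^ 2)) / √(1 - r ^ 2))))
      Filter.atTop (nhds 0) := by
    have ht : Filter.Tendsto (fun x => (x - r * v) / √(1 - r ^ 2)) Filter.atTop Filter.atTop :=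
      (Filter.tendsto_atTop_add_const_right _ (-(r * v)) Filter.tendsto_id).atTop_div_const hpos
    simpa using (((tendsto_gφ_atTop.comp ht).div_const √(1 - r ^ 2)).const_mul (gφ v)).neg
  rw [integral_Ioi_of_hasDerivAt_of_tendsto (hd u).continuousAt.continuousWithinAt
    (fun x _ => hd x) hi hlim]
  ring

theorem hasDerivAt_gaussianQuadrant {r : ℝ} (hr : 0 < 1 - r ^ 2) (u v : ℝ) :
    HasDerivAt (gaussianQuadrant u v)
      (gφ v * (gφ ((u - r * v) / √(1 - r ^ 2)) / √(1 - r ^ 2))) r := by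
  set δ : ℝ := (1 - r ^ 2) / 2 with hδ
  have hδ0 : 0 < δ := by positivity
  have hopen : {ρ : ℝ | δ < 1 - ρ ^ 2} ∈ nhds r :=
    (isOpen_lt continuous_const (by fun_prop)).mem_nhds (by simp only [Set.mem_ofPred_eq]; linarith)
  have hmeas : ∀ ρ : ℝ, Continuous fun x => gφ x * gaussianTail ((v - ρ * x) / √(1 - ρ ^ 2)) :=
    fun ρ => continuous_gφ.mul (continuous_gaussianTail.comp (by fun_prop))
  have hmeas' : Continuous fun x => gφ x * (gφ ((v - r * x) / √(1 - r ^ 2))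
      * ((x - r * v) / √(1 - r ^ 2) ^ 3)) :=
    continuous_gφ.mul ((continuous_gφ.comp (by fun_prop)).mul (by fun_prop))
  have key := hasDerivAt_integral_of_dominated_loc_of_deriv_le
    (μ := volume.restrict (Set.Ioi u)) (x₀ := r) (s := {ρ : ℝ | δ < 1 - ρ ^ 2})
    (F := fun ρ x => gφ x * gaussianTail ((v - ρ * x) / √(1 - ρ ^ 2)))
    (F' := fun ρ x => gφ x * (gφ ((v - ρ * x) / √(1 - ρ ^ 2))
      * ((x - ρ * v) / √(1 - ρ ^ 2) ^ 3)))
    (bound := fun x => gφ x * (|x| + |v|) / √δ ^ 3) hopen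
    (Filter.Eventually.of_forall fun ρ => (hmeas ρ).aestronglyMeasurable)
    (integrable_gφ.integrableOn.mono' (hmeas r).aestronglyMeasurable (ae_of_all _ fun x => ?_))
    hmeas'.aestronglyMeasurable
    (ae_of_all _ fun x ρ hρ => ?_)
    ((integrable_gφ_mul_abs_add |v|).div_const _).integrableOn
    (ae_of_all _ fun x ρ hρ => ?_)
  · rw [integral_deriv_gaussianQuadrant hr u v key.1] at key
    exact key.2
  · rw [norm_mul, Real.norm_of_nonneg (gφ_pos x).le]
    exact mul_le_of_le_one_right (gφ_pos x).le (norm_gaussianTail_le_one _)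
  · have hρ' : δ < 1 - ρ ^ 2 := hρ
    have hρ1 : |ρ| ≤ 1 := (sq_le_one_iff_abs_le_one ρ).1 (by linarith)
    rw [norm_mul, norm_mul, Real.norm_of_nonneg (gφ_pos x).le, Real.norm_of_nonneg (gφ_pos _).le,
      norm_div, norm_pow, Real.norm_of_nonneg (Real.sqrt_nonneg _), Real.norm_eq_abs, mul_div_assoc]
    refine mul_le_mul_of_nonneg_left ?_ (gφ_pos x).le
    refine (mul_le_of_le_one_left (by positivity) (gφ_le_one _)).trans ?_
    have h3 : |x - ρ * v| ≤ |x| + |v| := by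
      refine (abs_sub _ _).trans ?_
      rw [abs_mul]
      gcongr
      exact mul_le_of_le_one_left (abs_nonneg v) hρ1
    have : 0 < √δ := Real.sqrt_pos.2 hδ0
    gcongr
  · have hρ' : 0 < 1 - ρ ^ 2 := hδ0.trans hρ
    refine (((hasDerivAt_gaussianTail _).comp ρ
      (hasDerivAt_conditional_threshold hρ' x v)).const_mul (gφ x)).congr_deriv ?_
    ring

theorem hasSum_gaussianQuadrant_sub {r : ℝ} (hr : |r| < 1) (u v : ℝ) :
    HasSum (fun q : ℕ => H q u * H q v * gφ u * gφ v * r ^ (q + 1) / ((q + 1).factorial : ℝ))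
      (gaussianQuadrant u v r - gaussianQuadrant u v 0) := by
  have habs : ∀ ρ ∈ Set.uIcc 0 r, |ρ| ≤ |r| := fun ρ hρ => by
    simpa using Set.abs_sub_left_of_mem_uIcc hρ
  have hpos : ∀ ρ ∈ Set.uIcc 0 r, 0 < 1 - ρ ^ 2 := fun ρ hρ => by
    have := (sq_lt_one_iff_abs_lt_one ρ).2 ((habs ρ hρ).trans_lt hr); linarith
  have hcont : ContinuousOn
      (fun ρ => gφ v * (gφ ((u - ρ * v) / √(1 - ρ ^ 2)) / √(1 - ρ ^ 2))) (Set.uIcc 0 r) := by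
    have hne : ∀ ρ ∈ Set.uIcc 0 r, √(1 - ρ ^ 2) ≠ 0 := fun ρ hρ =>
      (Real.sqrt_pos.2 (hpos ρ hρ)).ne'
    have hs : ContinuousOn (fun ρ : ℝ => √(1 - ρ ^ 2)) (Set.uIcc 0 r) := by fun_prop
    have hd : ContinuousOn (fun ρ : ℝ => u - ρ * v) (Set.uIcc 0 r) := by fun_prop
    exact continuousOn_const.mul
      ((continuous_gφ.comp_continuousOn (hd.div hs hne)).div hs hne)
  rw [← intervalIntegral.integral_eq_sub_of_hasDerivAt
    (fun ρ hρ => hasDerivAt_gaussianQuadrant (hpos ρ hρ) u v) hcont.intervalIntegrable]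
  have hsum := ((hasSum_mehler (r := |r|) (by rwa [abs_abs]) u v).summable.mul_left (gφ v)).norm
  have key := intervalIntegral.hasSum_integral_of_dominated_convergence (μ := volume)
    (a := 0) (b := r)
    (F := fun (q : ℕ) ρ => gφ v * (H q u * H q v * gφ u * ρ ^ q / (q.factorial : ℝ)))
    (f := fun ρ => gφ v * (gφ ((u - ρ * v) / √(1 - ρ ^ 2)) / √(1 - ρ ^ 2)))
    (fun q _ => ‖gφ v * (H q u * H q v * gφ u * |r| ^ q / (q.factorial : ℝ))‖)
    (fun q => by
      have : Continuous fun ρ : ℝ =>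
        gφ v * (H q u * H q v * gφ u * ρ ^ q / (q.factorial : ℝ)) := by fun_prop
      exact this.aestronglyMeasurable)
    (fun q => ae_of_all _ fun ρ hρ => by
      have := habs ρ (Set.uIoc_subset_uIcc hρ)
      simp only [norm_mul, norm_div, norm_pow, Real.norm_eq_abs, abs_abs]
      gcongr)
    (ae_of_all _ fun _ _ => hsum) intervalIntegrable_const
    (ae_of_all _ fun ρ hρ =>
      (hasSum_mehler ((habs ρ (Set.uIoc_subset_uIcc hρ)).trans_lt hr) u v).mul_left _)
  convert key using 2 with q
  · rfl
  have e : ∀ ρ : ℝ, gφ v * (H q u * H q v * gφ u * ρ ^ q / (q.factorial : ℝ))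
      = (H q u * H q v * gφ u * gφ v / (q.factorial : ℝ)) * ρ ^ q := fun ρ => by ring
  simp_rw [e]
  rw [intervalIntegral.integral_const_mul, integral_pow, Nat.factorial_succ]
  push_cast
  simp
  field_simp

theorem measurable_indicator_mul_indicator (u v a b : ℝ) :
    Measurable fun p : ℝ × ℝ => (Set.Ici u).indicator (fun _ => (1 : ℝ)) p.1 *
      (Set.Ici v).indicator (fun _ => (1 : ℝ)) (a * p.1 + b * p.2) :=
  ((measurable_const.indicator measurableSet_Ici).comp measurable_fst).mul
    ((measurable_const.indicator measurableSet_Ici).comp (by fun_prop))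

theorem integral_indicator_mul_indicator_prod {r : ℝ} (hr : 0 < 1 - r ^ 2) (u v : ℝ) :
    ∫ p : ℝ × ℝ, (Set.Ici u).indicator (fun _ => (1 : ℝ)) p.1 *
        (Set.Ici v).indicator (fun _ => (1 : ℝ)) (r * p.1 + √(1 - r ^ 2) * p.2)
        ∂((gaussianReal 0 1).prod (gaussianReal 0 1)) = gaussianQuadrant u v r := by
  have hpos : 0 < √(1 - r ^ 2) := Real.sqrt_pos.2 hr
  have hone : ∀ (a x : ℝ), ‖(Set.Ici a).indicator (fun _ => (1 : ℝ)) x‖ ≤ 1 := fun a x => by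
    by_cases h : x ∈ Set.Ici a <;> simp [h]
  rw [integral_prod _ (Integrable.of_bound
    (measurable_indicator_mul_indicator _ _ _ _).aestronglyMeasurable 1
    (ae_of_all _ fun p => by
      rw [norm_mul]; exact mul_le_one₀ (hone _ _) (norm_nonneg _) (hone _ _)))]
  have hinner : ∀ x : ℝ, ∫ y, (Set.Ici u).indicator (fun _ => (1 : ℝ)) x *
      (Set.Ici v).indicator (fun _ => (1 : ℝ)) (r * x + √(1 - r ^ 2) * y) ∂gaussianReal 0 1
      = (Set.Ici u).indicator (fun _ => (1 : ℝ)) x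
        * gaussianTail ((v - r * x) / √(1 - r ^ 2)) := by
    intro x
    rw [integral_const_mul, ← gaussianTail_eq_integral]
    congr 2
    funext y
    refine Set.indicator_eq_indicator (f := fun _ => (1 : ℝ)) ?_ rfl
    rw [Set.mem_Ici, Set.mem_Ici, div_le_iff₀ hpos, sub_le_iff_le_add']
    ring_nf
  simp_rw [hinner]
  rw [integral_gaussianReal_eq_integral_smul one_ne_zero, gaussianQuadrant,
    ← integral_Ici_eq_integral_Ioi, ← integral_indicator measurableSet_Ici,
    gφ_eq_gaussianPDFReal]
  refine integral_congr_ae (ae_of_all _ fun x => ?_)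
  by_cases h : x ∈ Set.Ici u <;> simp [h]

theorem map_rotation_gaussianReal {Ω : Type*} [MeasurableSpace Ω] {μ : Measure Ω}
    {X Y : Ω → ℝ} (hX : Measurable X) (hY : Measurable Y) (hind : IndepFun X Y μ)
    (hXlaw : Measure.map X μ = gaussianReal 0 1) (hYlaw : Measure.map Y μ = gaussianReal 0 1)
    {r : ℝ} (hr : 0 < 1 - r ^ 2) :
    Measure.map (fun ω => r * X ω + √(1 - r ^ 2) * Y ω) μ = gaussianReal 0 1 := by
  have hXr := (gaussianReal_const_mul ⟨hX.aemeasurable, hXlaw⟩ r).map_eq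
  have hYs := (gaussianReal_const_mul ⟨hY.aemeasurable, hYlaw⟩ √(1 - r ^ 2)).map_eq
  have hind' : IndepFun (fun ω => r * X ω) (fun ω => √(1 - r ^ 2) * Y ω) μ :=
    hind.comp (φ := fun x => r * x) (ψ := fun y => √(1 - r ^ 2) * y) (by fun_prop) (by fun_prop)
  have h := gaussianReal_add_gaussianReal_of_indepFun hind' hXr hYs
  refine h.trans ?_
  congr 1
  · simp
  · ext
    simp [Real.sq_sqrt hr.le]

/-- If `N, N'` are independent standard Gaussians and `|r| < 1`, then
`Cov(1_{N ≥ u}, 1_{rN + √(1-r²)N' ≥ v}) = ∑_{q ≥ 1} H_{q-1}(u) H_{q-1}(v) φ(u) φ(v) r^q / q!`. -/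
theorem cov_indicators_eq_hermite_series
    {Ω : Type*} [MeasureSpace Ω] [IsProbabilityMeasure (ℙ : Measure Ω)]
    (N N' : Ω → ℝ) (hmN : Measurable N) (hmN' : Measurable N')
    (hind : IndepFun N N' ℙ)
    (hN : Measure.map N ℙ = gaussianReal 0 1)
    (hN' : Measure.map N' ℙ = gaussianReal 0 1)
    (r : ℝ) (hr : |r| < 1) (u v : ℝ) :
    (∫ ω, (Set.Ici u).indicator (fun _ => (1 : ℝ)) (N ω) *
        (Set.Ici v).indicator (fun _ => (1 : ℝ))
          (r * N ω + Real.sqrt (1 - r ^ 2) * N' ω) ∂ℙ)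
      - (∫ ω, (Set.Ici u).indicator (fun _ => (1 : ℝ)) (N ω) ∂ℙ) *
        (∫ ω, (Set.Ici v).indicator (fun _ => (1 : ℝ))
          (r * N ω + Real.sqrt (1 - r ^ 2) * N' ω) ∂ℙ)
    = ∑' q : ℕ, H q u * H q v * gφ u * gφ v * r ^ (q + 1) / (Nat.factorial (q + 1) : ℝ) := by
  have hr2 : 0 < 1 - r ^ 2 := by
    have := (sq_lt_one_iff_abs_lt_one r).2 hr; linarith
  have hmeas : ∀ a : ℝ, Measurable ((Set.Ici a).indicator fun _ => (1 : ℝ)) := fun a =>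
    measurable_const.indicator measurableSet_Ici
  have hjoint := integral_indicator_mul_indicator_prod hr2 u v
  have hlaw : (gaussianReal 0 1).prod (gaussianReal 0 1)
      = Measure.map (fun ω => (N ω, N' ω)) ℙ := by
    rw [(indepFun_iff_map_prod_eq_prod_map_map hmN.aemeasurable hmN'.aemeasurable).1 hind, hN, hN']
  rw [hlaw, integral_map (hmN.prodMk hmN').aemeasurable
    (measurable_indicator_mul_indicator _ _ _ _).aestronglyMeasurable]
    at hjoint
  have hu := gaussianTail_eq_integral u
  rw [← hN, integral_map hmN.aemeasurable (hmeas u).aestronglyMeasurable] at hu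
  have hv := gaussianTail_eq_integral v
  rw [← map_rotation_gaussianReal hmN hmN' hind hN hN' hr2,
    integral_map (by fun_prop) (hmeas v).aestronglyMeasurable] at hv
  rw [(hasSum_gaussianQuadrant_sub hr u v).tsum_eq, gaussianQuadrant_zero, hjoint, hu, hv]
end

section
/- Let B = (B_x)_{x∈E} be a measurable centered Gaussian field on a finite measure space (E, A, μ) with B_x standard normal for each x and covariance kernel K(x,y) = E[B_x B_y]. Suppose ∫_{E×E} K(x,y)^q dμ(x)dμ(y) ≍ q^{-β} for some β > 0. Then for every u ∈ ℝ and every positive integer p, the excursion measure V(u) = ∫_E 1_{B_x ≥ u} dμ(x) belongs to the Malliavin–Sobolev space D^{p,2} if and only if p < β + 1/2. -/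
open MeasureTheory ProbabilityTheory

open Filter Topology in
/-- A solution of `b (n + 2) + b n = u ε (n + 1) b (n + 1)` with `ε` decreasing to `0` has
`b (n + 1) ^ 2 + b n ^ 2` eventually bounded above and away from zero. -/
theorem exists_bounds_sq_add_sq_of_recurrence (b ε : ℕ → ℝ) (u : ℝ)
    (hanti : ∀ n, ε (n + 1) ≤ ε n) (hpos : ∀ n, 0 ≤ ε n) (hlim : Tendsto ε atTop (𝓝 0))
    (hrec : ∀ n, b (n + 2) + b n = u * ε (n + 1) * b (n + 1)) (h0 : b 0 ≠ 0) :
    ∃ c C : ℝ, 0 < c ∧ 0 < C ∧ ∃ N : ℕ, ∀ n, N ≤ n →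
      c ≤ b (n + 1) ^ 2 + b n ^ 2 ∧ b (n + 1) ^ 2 + b n ^ 2 ≤ C := by
  have hS : ∀ n, 0 < b (n + 1) ^ 2 + b n ^ 2 := by
    intro n
    induction n with
    | zero => positivity
    | succ n ih =>
      by_contra! hle
      have h1 : b (n + 1) = 0 := by nlinarith [sq_nonneg (b (n + 2)), sq_nonneg (b (n + 1))]
      have h2 : b (n + 2) = 0 := by nlinarith [sq_nonneg (b (n + 2)), sq_nonneg (b (n + 1))]
      have h3 := hrec n
      rw [h1, h2] at h3
      have h4 : b n = 0 := by linarith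
      simp [h1, h4] at ih
  set e : ℕ → ℝ := fun n => |u| * ε (n + 1) with he
  set F : ℕ → ℝ := fun n => b (n + 1) ^ 2 + b n ^ 2 - u * ε (n + 1) * b (n + 1) * b n with hF
  have he0 : ∀ n, 0 ≤ e n := fun n => mul_nonneg (abs_nonneg _) (hpos _)
  have helim : Tendsto e atTop (𝓝 0) := by
    simpa using ((tendsto_add_atTop_iff_nat 1).2 hlim).const_mul |u|
  have hehalf : ∀ᶠ n in atTop, e n ≤ 1 / 2 :=
    (helim.eventually_lt_const (by norm_num : (0 : ℝ) < 1 / 2)).mono fun _ h => h.le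
  obtain ⟨N, hN⟩ := eventually_atTop.1 hehalf
  have hprod : ∀ (x y t : ℝ), 0 ≤ t → |u * t * x * y| ≤ |u| * t * (x ^ 2 + y ^ 2) / 2 := by
    intro x y t ht
    rw [abs_mul, abs_mul, abs_mul, abs_of_nonneg ht]
    have h1 : |x| * |y| ≤ (x ^ 2 + y ^ 2) / 2 := by
      rw [← sq_abs x, ← sq_abs y]
      nlinarith [sq_nonneg (|x| - |y|)]
    nlinarith [mul_le_mul_of_nonneg_left h1 (mul_nonneg (abs_nonneg u) ht)]
  have hFS : ∀ n, N ≤ n → (b (n + 1) ^ 2 + b n ^ 2) / 2 ≤ F n ∧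
      F n ≤ 2 * (b (n + 1) ^ 2 + b n ^ 2) := by
    intro n hn
    have h1 := abs_le.1 (hprod (b (n + 1)) (b n) (ε (n + 1)) (hpos _))
    have h2 : e n * (b (n + 1) ^ 2 + b n ^ 2) ≤ 1 / 2 * (b (n + 1) ^ 2 + b n ^ 2) :=
      mul_le_mul_of_nonneg_right (hN n hn) (hS n).le
    simp only [he] at h2
    simp only [hF]
    constructor <;> linarith [h1.1, h1.2, hS n]
  have hFpos : ∀ n, N ≤ n → 0 < F n := fun n hn => by linarith [hS n, (hFS n hn).1]
  have hstep : ∀ n, N ≤ n → |F (n + 1) - F n| ≤ (e n - e (n + 1)) * F (n + 1) := by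
    intro n hn
    have hdiff : F (n + 1) - F n
        = u * (ε (n + 1) - ε (n + 2)) * b (n + 2) * b (n + 1) := by
      have h1 : b n = u * ε (n + 1) * b (n + 1) - b (n + 2) := by linarith [hrec n]
      simp only [hF, h1]
      ring
    rw [hdiff]
    have hd : 0 ≤ ε (n + 1) - ε (n + 2) := sub_nonneg.2 (hanti (n + 1))
    refine (hprod _ _ _ hd).trans ?_
    have h2 := mul_le_mul_of_nonneg_left (hFS (n + 1) (by omega)).1
      (mul_nonneg (abs_nonneg u) hd)
    simp only [he]
    linarith
  have hemono : ∀ n, e (n + 1) ≤ e n := fun n =>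
    mul_le_mul_of_nonneg_left (hanti (n + 1)) (abs_nonneg u)
  have hlow : ∀ n, N ≤ n → F N * (1 - e N) ≤ F n * (1 - e n) := by
    intro n hn
    induction n, hn using Nat.le_induction with
    | base => exact le_rfl
    | succ n hn ih =>
      refine ih.trans ?_
      have h1 := (abs_le.1 (hstep n hn)).1
      have hx : 0 ≤ e n - e (n + 1) := sub_nonneg.2 (hemono n)
      have h2 : F n * (1 - e n) ≤ (F (n + 1) * (1 + (e n - e (n + 1)))) * (1 - e n) :=
        mul_le_mul_of_nonneg_right (by linarith) (by linarith [hN n hn])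
      have h3 : 0 ≤ F (n + 1) * ((e n - e (n + 1)) * e n) :=
        mul_nonneg (hFpos _ (by omega)).le (mul_nonneg hx (he0 n))
      linarith
  have hup : ∀ n, N ≤ n → F n * (1 + 2 * e n) ≤ F N * (1 + 2 * e N) := by
    intro n hn
    induction n, hn using Nat.le_induction with
    | base => exact le_rfl
    | succ n hn ih =>
      refine le_trans ?_ ih
      have h1 := (abs_le.1 (hstep n hn)).2
      have hx : 0 ≤ e n - e (n + 1) := sub_nonneg.2 (hemono n)
      have h2 : (F (n + 1) * (1 - (e n - e (n + 1)))) * (1 + 2 * e n) ≤ F n * (1 + 2 * e n) :=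
        mul_le_mul_of_nonneg_right (by linarith) (by linarith [he0 n])
      have h3 : 0 ≤ F (n + 1) * ((e n - e (n + 1)) * (1 - 2 * e n)) :=
        mul_nonneg (hFpos _ (by omega)).le (mul_nonneg hx (by linarith [hN n hn]))
      linarith
  have hFN := hFpos N le_rfl
  have heN := hN N le_rfl
  refine ⟨F N * (1 - e N) / 2, 2 * (F N * (1 + 2 * e N)), ?_, ?_, N, fun n hn => ⟨?_, ?_⟩⟩
  · have : 0 < 1 - e N := by linarith
    positivity
  · have := he0 N
    positivity
  · have h1 : F n * (1 - e n) ≤ F n := by nlinarith [hFpos n hn, he0 n]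
    linarith [hlow n hn, (hFS n hn).2]
  · have h1 : F n ≤ F n * (1 + 2 * e n) := by nlinarith [hFpos n hn, he0 n]
    linarith [hup n hn, (hFS n hn).1]

/-- Up to a constant, the `n`-th absolute moment of the standard Gaussian. -/
noncomputable def gaussMoment (n : ℕ) : ℝ := √2 ^ n * Real.Gamma (((n : ℝ) + 1) / 2)

theorem gaussMoment_pos (n : ℕ) : 0 < gaussMoment n :=
  mul_pos (by positivity) (Real.Gamma_pos_of_pos (by positivity))

theorem gaussMoment_add_two (n : ℕ) : gaussMoment (n + 2) = (n + 1) * gaussMoment n := by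
  have h1 : (((n + 2 : ℕ) : ℝ) + 1) / 2 = ((n : ℝ) + 1) / 2 + 1 := by push_cast; ring
  have h2 : √2 ^ 2 = (2 : ℝ) := Real.sq_sqrt (by norm_num)
  rw [gaussMoment, gaussMoment, h1, Real.Gamma_add_one (by positivity), pow_add, h2]
  ring

theorem gaussMoment_sq_le (n : ℕ) :
    gaussMoment (n + 1) ^ 2 ≤ gaussMoment n * gaussMoment (n + 2) := by
  have hs : (0 : ℝ) < ((n : ℝ) + 1) / 2 := by positivity
  have ht : (0 : ℝ) < (((n + 2 : ℕ) : ℝ) + 1) / 2 := by positivity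
  have h := Real.Gamma_mul_add_mul_le_rpow_Gamma_mul_rpow_Gamma hs ht
    (by norm_num : (0 : ℝ) < 1 / 2) (by norm_num : (0 : ℝ) < 1 / 2) (by norm_num)
  have h1 : 1 / 2 * (((n : ℝ) + 1) / 2) + 1 / 2 * ((((n + 2 : ℕ) : ℝ) + 1) / 2)
      = (((n + 1 : ℕ) : ℝ) + 1) / 2 := by push_cast; ring
  have hGs := Real.Gamma_pos_of_pos hs
  have hGt := Real.Gamma_pos_of_pos ht
  rw [h1, ← Real.sqrt_eq_rpow, ← Real.sqrt_eq_rpow, ← Real.sqrt_mul hGs.le] at h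
  have h2 := (Real.le_sqrt (Real.Gamma_pos_of_pos (by positivity)).le (by positivity)).1 h
  calc gaussMoment (n + 1) ^ 2
      = (√2 ^ (n + 1)) ^ 2 * Real.Gamma ((((n + 1 : ℕ) : ℝ) + 1) / 2) ^ 2 := by
        rw [gaussMoment, mul_pow]
    _ ≤ (√2 ^ (n + 1)) ^ 2 * (Real.Gamma (((n : ℝ) + 1) / 2)
          * Real.Gamma ((((n + 2 : ℕ) : ℝ) + 1) / 2)) := by gcongr
    _ = gaussMoment n * gaussMoment (n + 2) := by
        rw [gaussMoment, gaussMoment]; ring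

theorem gaussMoment_mul_succ (n : ℕ) :
    gaussMoment n * gaussMoment (n + 1) = gaussMoment 0 * gaussMoment 1 * n.factorial := by
  induction n with
  | zero => simp
  | succ n ih =>
    rw [gaussMoment_add_two, Nat.factorial_succ]
    push_cast
    linear_combination ((n : ℝ) + 1) * ih

/-- Two-sided estimate for the normalized Hermite polynomials at a fixed point: two consecutive
values cannot both be small compared with `q ^ (-1 / 2)`. -/
theorem exists_bounds_hermite_sq (u : ℝ) :
    ∃ c C : ℝ, 0 < c ∧ 0 < C ∧ ∃ N : ℕ, ∀ q, N ≤ q →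
      c ≤ √((q : ℝ) + 1) * (H q u ^ 2 / q.factorial)
          + √((q : ℝ) + 2) * (H (q + 1) u ^ 2 / (q + 1).factorial) ∧
      √((q : ℝ) + 1) * (H q u ^ 2 / q.factorial) ≤ C := by
  set ε : ℕ → ℝ := fun n => gaussMoment n / gaussMoment (n + 1) with hε
  have hεpos : ∀ n, 0 < ε n := fun n => div_pos (gaussMoment_pos _) (gaussMoment_pos _)
  have hεmul : ∀ n, ε n * ε (n + 1) = 1 / ((n : ℝ) + 1) := by
    intro n
    have h0 := (gaussMoment_pos n).ne'
    have h1 := (gaussMoment_pos (n + 1)).ne'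
    simp only [hε]
    rw [gaussMoment_add_two]
    field_simp
  have hanti : ∀ n, ε (n + 1) ≤ ε n := by
    intro n
    simp only [hε]
    rw [div_le_div_iff₀ (gaussMoment_pos _) (gaussMoment_pos _)]
    have := gaussMoment_sq_le n
    rw [sq] at this
    exact this
  have hlow : ∀ n : ℕ, 1 ≤ √((n : ℝ) + 1) * ε n := by
    intro n
    have h1 : 1 / ((n : ℝ) + 1) ≤ ε n ^ 2 := by
      rw [← hεmul n, sq]
      exact mul_le_mul_of_nonneg_left (hanti n) (hεpos n).le
    have h2 : √(1 / ((n : ℝ) + 1)) ≤ ε n := Real.sqrt_le_iff.2 ⟨(hεpos n).le, h1⟩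
    rw [one_div, Real.sqrt_inv] at h2
    exact (inv_le_iff_one_le_mul₀' (by positivity)).1 h2
  have hupp : ∀ n : ℕ, √((n : ℝ) + 1) * ε (n + 1) ≤ 1 := by
    intro n
    have h1 : ε (n + 1) ^ 2 ≤ 1 / ((n : ℝ) + 1) := by
      rw [← hεmul n, sq]
      exact mul_le_mul_of_nonneg_right (hanti n) (hεpos (n + 1)).le
    have h2 : ε (n + 1) ≤ √(1 / ((n : ℝ) + 1)) := Real.le_sqrt_of_sq_le h1
    rw [one_div, Real.sqrt_inv] at h2
    calc √((n : ℝ) + 1) * ε (n + 1) ≤ √((n : ℝ) + 1) * (√((n : ℝ) + 1))⁻¹ := by gcongr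
      _ = 1 := mul_inv_cancel₀ (by positivity)
  have hlim : Filter.Tendsto ε Filter.atTop (nhds 0) := by
    rw [← Filter.tendsto_add_atTop_iff_nat 1]
    have h1 : Filter.Tendsto (fun n : ℕ => √((n : ℝ) + 1)) Filter.atTop Filter.atTop :=
      Real.tendsto_sqrt_atTop.comp
        (Filter.tendsto_atTop_add_const_right _ _ tendsto_natCast_atTop_atTop)
    refine squeeze_zero (fun n => (hεpos _).le) (fun n => ?_) h1.inv_tendsto_atTop
    have h2 : (0 : ℝ) < √((n : ℝ) + 1) := by positivity
    exact (le_inv_mul_iff₀ h2).2 (hupp n) |>.trans_eq (mul_one _)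
  set b : ℕ → ℝ := fun n => H n u / gaussMoment n with hb
  have hrec : ∀ n, b (n + 2) + b n = u * ε (n + 1) * b (n + 1) := by
    intro n
    have h0 := (gaussMoment_pos n).ne'
    have h1 := (gaussMoment_pos (n + 1)).ne'
    simp only [hb, hε]
    rw [gaussMoment_add_two, H]
    field_simp
    ring
  have hb0 : b 0 ≠ 0 := by
    simp only [hb, H]
    exact (div_pos one_pos (gaussMoment_pos 0)).ne'
  obtain ⟨c, C, hc, hC, N, hN⟩ := exists_bounds_sq_add_sq_of_recurrence b ε u hanti
    (fun n => (hεpos n).le) hlim hrec hb0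
  set A : ℝ := gaussMoment 0 * gaussMoment 1 with hA
  have hApos : 0 < A := mul_pos (gaussMoment_pos 0) (gaussMoment_pos 1)
  have hsq : ∀ q : ℕ, H q u ^ 2 / q.factorial = A * ε q * b q ^ 2 := by
    intro q
    have h0 := (gaussMoment_pos q).ne'
    have h1 := (gaussMoment_pos (q + 1)).ne'
    have h2 : (q.factorial : ℝ) ≠ 0 := by positivity
    have h3 := gaussMoment_mul_succ q
    simp only [hb, hε]
    field_simp
    linear_combination H q u ^ 2 * h3
  have hge : ∀ q : ℕ, A * b q ^ 2 ≤ √((q : ℝ) + 1) * (H q u ^ 2 / q.factorial) := by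
    intro q
    rw [hsq]
    have := mul_le_mul_of_nonneg_right (hlow q) (mul_nonneg hApos.le (sq_nonneg (b q)))
    linarith
  refine ⟨A * c, 2 * A * C, by positivity, by positivity, N + 1, fun q hq => ⟨?_, ?_⟩⟩
  · have h1 := hge q
    have h2 := hge (q + 1)
    have h3 : (((q + 1 : ℕ) : ℝ) + 1) = (q : ℝ) + 2 := by push_cast; ring
    rw [h3] at h2
    have h4 := mul_le_mul_of_nonneg_left (hN q (by omega)).1 hApos.le
    linarith
  · obtain ⟨m, rfl⟩ : ∃ m, q = m + 1 := ⟨q - 1, by omega⟩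
    have h1 : √(((m + 1 : ℕ) : ℝ) + 1) ≤ 2 * √((m : ℝ) + 1) := by
      rw [show (2 : ℝ) = √4 by rw [show (4 : ℝ) = 2 ^ 2 by norm_num]; simp,
        ← Real.sqrt_mul (by norm_num)]
      apply Real.sqrt_le_sqrt
      push_cast
      linarith [(Nat.cast_nonneg m : (0 : ℝ) ≤ m)]
    have h2 : √(((m + 1 : ℕ) : ℝ) + 1) * ε (m + 1) ≤ 2 := by
      have := mul_le_mul_of_nonneg_right h1 (hεpos (m + 1)).le
      linarith [hupp m]
    have h3 : b (m + 1) ^ 2 ≤ C := by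
      linarith [(hN (m + 1) (by omega)).2, sq_nonneg (b (m + 2))]
    rw [hsq]
    calc √(((m + 1 : ℕ) : ℝ) + 1) * (A * ε (m + 1) * b (m + 1) ^ 2)
        = (√(((m + 1 : ℕ) : ℝ) + 1) * ε (m + 1)) * (A * b (m + 1) ^ 2) := by ring
      _ ≤ 2 * (A * C) := by gcongr
      _ = 2 * A * C := by ring

/-- If `w` is bounded and `w q + w (q + 1)` is bounded below, then a series with terms
comparable to `w q * (q + 1) ^ s` converges if and only if `s < -1`. -/
theorem summable_iff_of_comparable (T w : ℕ → ℝ) (s c C d D : ℝ) (hc : 0 < c)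
    (hd : 0 < d) (hD : 0 < D) (hw : ∀ q, 0 ≤ w q) (N : ℕ)
    (hwb : ∀ q, N ≤ q → c ≤ w q + w (q + 1) ∧ w q ≤ C)
    (hT : ∀ q : ℕ, N ≤ q → d * (w q * ((q : ℝ) + 1) ^ s) ≤ T q ∧
      T q ≤ D * (w q * ((q : ℝ) + 1) ^ s)) :
    Summable T ↔ s < -1 := by
  constructor
  · intro hsum
    by_contra! hs
    have hbase : ∀ q : ℕ, (((q : ℝ) + 2))⁻¹ ≤ ((q : ℝ) + 1) ^ s := by
      intro q
      have hq : (0 : ℝ) ≤ q := Nat.cast_nonneg q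
      calc (((q : ℝ) + 2))⁻¹ ≤ ((q : ℝ) + 1)⁻¹ := by gcongr; norm_num
        _ = ((q : ℝ) + 1) ^ (-1 : ℝ) := (Real.rpow_neg_one _).symm
        _ ≤ ((q : ℝ) + 1) ^ s := Real.rpow_le_rpow_of_exponent_le (by linarith) hs
    have hbase' : ∀ q : ℕ, (((q : ℝ) + 2))⁻¹ ≤ (((q + 1 : ℕ) : ℝ) + 1) ^ s := by
      intro q
      have hq : (0 : ℝ) ≤ q := Nat.cast_nonneg q
      calc (((q : ℝ) + 2))⁻¹ = (((q + 1 : ℕ) : ℝ) + 1) ^ (-1 : ℝ) := by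
            rw [Real.rpow_neg_one]; push_cast; ring
        _ ≤ (((q + 1 : ℕ) : ℝ) + 1) ^ s :=
            Real.rpow_le_rpow_of_exponent_le (by push_cast; linarith) hs
    have hsum2 : Summable fun q => T q + T (q + 1) :=
      hsum.add ((summable_nat_add_iff 1).2 hsum)
    have hharm : Summable fun q : ℕ => d * c * ((q : ℝ) + 2)⁻¹ := by
      refine Summable.of_norm_bounded_eventually_nat hsum2 ?_
      filter_upwards [Filter.eventually_ge_atTop N] with q hq
      rw [Real.norm_of_nonneg (by positivity)]
      have h1 := (hT q hq).1
      have h2 := (hT (q + 1) (by omega)).1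
      have h3 := mul_le_mul_of_nonneg_left (hbase q) (hw q)
      have h4 := mul_le_mul_of_nonneg_left (hbase' q) (hw (q + 1))
      have h5 : c * ((q : ℝ) + 2)⁻¹ ≤ (w q + w (q + 1)) * ((q : ℝ) + 2)⁻¹ :=
        mul_le_mul_of_nonneg_right (hwb q hq).1 (by positivity)
      have h6 := mul_le_mul_of_nonneg_left (h5.trans
        ((add_mul _ _ _).le.trans (add_le_add h3 h4))) hd.le
      linarith
    have hharm' : Summable fun q : ℕ => (((q + 2 : ℕ) : ℝ))⁻¹ := by
      have := (summable_mul_left_iff (mul_pos hd hc).ne').1 hharm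
      exact_mod_cast this
    exact Real.not_summable_natCast_inv
      ((summable_nat_add_iff (f := fun q : ℕ => ((q : ℝ))⁻¹) 2).1 hharm')
  · intro hs
    have h1 : Summable fun q : ℕ => D * C * ((q : ℝ) + 1) ^ s := by
      have := (summable_nat_add_iff (f := fun q : ℕ => (q : ℝ) ^ s) 1).2
        (Real.summable_nat_rpow.2 hs)
      exact (by exact_mod_cast this : Summable fun q : ℕ => ((q : ℝ) + 1) ^ s).mul_left _
    refine Summable.of_norm_bounded_eventually_nat h1 ?_
    filter_upwards [Filter.eventually_ge_atTop N] with q hq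
    have hp : (0 : ℝ) ≤ ((q : ℝ) + 1) ^ s := by positivity
    have h2 : 0 ≤ T q :=
      (mul_nonneg hd.le (mul_nonneg (hw q) hp)).trans (hT q hq).1
    rw [Real.norm_of_nonneg h2]
    refine (hT q hq).2.trans ?_
    have h3 := mul_le_mul_of_nonneg_left
      (mul_le_mul_of_nonneg_right (hwb q hq).2 hp) hD.le
    linarith

/-- Main theorem: for a Gaussian field with standard normal marginals on a finite measure
space whose covariance kernel satisfies `∫_{E²} K^q dμ dμ ≍ q^{-β}`, the excursion volume
`V(u)` belongs to `𝔻^{p,2}` iff `p < β + 1/2`.  Membership in `𝔻^{p,2}` is expressed, via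
the chaos decomposition `Var(V(u)[q]) = q! a_q² ∫ K^q` with `a_q = H_{q-1}(u) φ(u) / q!`,
as summability of `q ↦ q^p / q! · H_{q-1}(u)² φ(u)² ∫_{E²} K^q dμ dμ`. -/
theorem excursion_volume_malliavin_iff
    {E Ω : Type*} [MeasurableSpace E] [MeasureSpace Ω]
    [IsProbabilityMeasure (ℙ : Measure Ω)]
    (μ : Measure E) [IsFiniteMeasure μ]
    (B : E → Ω → ℝ) (hmeas : ∀ x, Measurable (B x))
    (hlaw : ∀ x, Measure.map (B x) ℙ = gaussianReal 0 1)
    (K : E → E → ℝ) (hK : ∀ x y, K x y = ∫ ω, B x ω * B y ω ∂ℙ)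
    (β : ℝ) (hβ : 0 < β)
    (hmom : ∃ c c' : ℝ, 0 < c ∧ 0 < c' ∧ ∃ Q : ℕ, ∀ q : ℕ, Q ≤ q →
      c * (q : ℝ) ^ (-β) ≤ (∫ z : E × E, K z.1 z.2 ^ q ∂(μ.prod μ)) ∧
      (∫ z : E × E, K z.1 z.2 ^ q ∂(μ.prod μ)) ≤ c' * (q : ℝ) ^ (-β))
    (u : ℝ) (p : ℕ) (hp : 0 < p) :
    Summable (fun q : ℕ =>
        ((q : ℝ) + 1) ^ p / (Nat.factorial (q + 1) : ℝ) * H q u ^ 2 * gφ u ^ 2 *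
          ∫ z : E × E, K z.1 z.2 ^ (q + 1) ∂(μ.prod μ))
      ↔ (p : ℝ) < β + 1 / 2 := by
  obtain ⟨m, M, hm, hM, Q, hQ⟩ := hmom
  obtain ⟨c, C, hc, hC, N, hN⟩ := exists_bounds_hermite_sq u
  have hg : 0 < gφ u ^ 2 := by
    unfold gφ
    have := Real.pi_pos
    positivity
  have key : ∀ q : ℕ, ((q : ℝ) + 1) ^ p / (Nat.factorial (q + 1) : ℝ) * H q u ^ 2 * gφ u ^ 2
      * ((q : ℝ) + 1) ^ (-β) = gφ u ^ 2 * (√((q : ℝ) + 1) * (H q u ^ 2 / q.factorial)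
        * ((q : ℝ) + 1) ^ ((p : ℝ) - 3 / 2 - β)) := by
    intro q
    have hq : (0 : ℝ) < (q : ℝ) + 1 := by positivity
    have hf : (q.factorial : ℝ) ≠ 0 := by positivity
    have h1 : √((q : ℝ) + 1) * ((q : ℝ) + 1) ^ ((p : ℝ) - 3 / 2 - β)
        = ((q : ℝ) + 1) ^ p / ((q : ℝ) + 1) * ((q : ℝ) + 1) ^ (-β) := by
      rw [Real.sqrt_eq_rpow, ← Real.rpow_add hq, ← Real.rpow_natCast,
        ← Real.rpow_sub_one hq.ne', ← Real.rpow_add hq]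
      congr 1
      ring
    rw [Nat.factorial_succ]
    push_cast
    calc _ = gφ u ^ 2 * (H q u ^ 2 / q.factorial)
            * (((q : ℝ) + 1) ^ p / ((q : ℝ) + 1) * ((q : ℝ) + 1) ^ (-β)) := by field_simp
      _ = _ := by rw [← h1]; ring
  rw [summable_iff_of_comparable _ (fun q => √((q : ℝ) + 1) * (H q u ^ 2 / q.factorial))
    ((p : ℝ) - 3 / 2 - β) c C (m * gφ u ^ 2) (M * gφ u ^ 2) hc (by positivity) (by positivity)
    (fun q => by positivity) (max N Q) ?_ ?_]
  · constructor <;> intro h <;> linarith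
  · intro q hq
    have h := hN q (le_of_max_le_left hq)
    refine ⟨?_, h.2⟩
    have h3 : (((q + 1 : ℕ) : ℝ) + 1) = (q : ℝ) + 2 := by push_cast; ring
    simp only [h3]
    exact h.1
  · intro q hq
    have h := hQ (q + 1) ((le_of_max_le_right hq).trans (Nat.le_succ q))
    push_cast at h
    have hA : 0 ≤ ((q : ℝ) + 1) ^ p / (Nat.factorial (q + 1) : ℝ) * H q u ^ 2 * gφ u ^ 2 := by
      positivity
    have h1 := mul_le_mul_of_nonneg_left h.1 hA
    have h2 := mul_le_mul_of_nonneg_left h.2 hA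
    have hk := key q
    constructor
    · rw [mul_assoc m, ← hk]
      linarith
    · rw [mul_assoc M, ← hk]
      linarith
end
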